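/- Let a ∈ ℝ with a ≠ 0. Then lim_{k→∞} (1/√k) · log( ∫_ℝ e^{2ax} h_k(x)² dx ) = 2^{3/2}·|a|. -/

import Mathlib

open MeasureTheory

/-- The physicists' Hermite polynomial `H_k` on `ℝ`. -/
noncomputable def physHermiteR (k : ℕ) (x : ℝ) : ℝ :=
  (-1) ^ k * Real.exp (x ^ 2) * iteratedDeriv k (fun t : ℝ => Real.exp (-t ^ 2)) x

/-- The Hermite function `h_k` on `ℝ`. -/
noncomputable def hermiteFunR (k : ℕ) (x : ℝ) : ℝ :=
  (Real.sqrt (2 ^ k * Nat.factorial k * Real.sqrt Real.pi))⁻¹ *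
    physHermiteR k x * Real.exp (-x ^ 2 / 2)


open Polynomial in
/-- The physicists' Hermite polynomials, with `H_{n+1} = 2 X H_n - DH_n` for the derivative `D`. -/
noncomputable def physHermitePoly : ℕ → ℝ[X]
  | 0 => 1
  | n + 1 => 2 * X * physHermitePoly n - derivative (physHermitePoly n)

section HermitePolynomials

open Polynomial

lemma derivative_physHermitePoly_succ (n : ℕ) :
    derivative (physHermitePoly (n + 1)) = (2 * ((n : ℝ) + 1)) • physHermitePoly n := by
  induction n with
  | zero => simp [physHermitePoly, Polynomial.smul_eq_C_mul, map_ofNat C 2]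
  | succ n ih =>
    have h : physHermitePoly (n + 2) =
        2 * X * physHermitePoly (n + 1) - (2 * ((n : ℝ) + 1)) • physHermitePoly n := by
      rw [← ih]; rfl
    rw [h]
    simp only [derivative_sub, derivative_mul, derivative_X, ih,
      Polynomial.smul_eq_C_mul]
    have h2 : physHermitePoly (n + 1) =
        2 * X * physHermitePoly n - derivative (physHermitePoly n) := rfl
    rw [h2]
    simp [map_ofNat C 2]
    ring

lemma iterate_derivative_physHermitePoly {j k : ℕ} (hjk : j ≤ k) :
    (derivative ^ j : Module.End ℝ ℝ[X]) (physHermitePoly k) =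
      (2 ^ j * (k.descFactorial j : ℝ)) • physHermitePoly (k - j) := by
  induction j with
  | zero => simp
  | succ j ih =>
    obtain ⟨m, rfl⟩ := Nat.exists_eq_add_of_lt hjk
    rw [pow_succ', Module.End.mul_apply, ih (by omega), map_smul,
      show j + m + 1 - j = m + 1 by omega, derivative_physHermitePoly_succ,
      show j + m + 1 - (j + 1) = m by omega, smul_smul, Nat.descFactorial_succ,
      show j + m + 1 - j = m + 1 by omega]
    congr 1
    push_cast
    ring

lemma iteratedDeriv_exp_neg_sq (k : ℕ) :
    iteratedDeriv k (fun t : ℝ => Real.exp (-t ^ 2)) =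
      fun x => (-1) ^ k * (physHermitePoly k).eval x * Real.exp (-x ^ 2) := by
  induction k with
  | zero => simp [physHermitePoly]
  | succ k ih =>
    rw [iteratedDeriv_succ, ih]
    funext x
    have h1 : HasDerivAt (fun t : ℝ => Real.exp (-t ^ 2)) (Real.exp (-x ^ 2) * -(2 * x)) x := by
      simpa using ((hasDerivAt_pow 2 x).neg).exp
    have h2 := (((physHermitePoly k).hasDerivAt x).const_mul ((-1 : ℝ) ^ k)).mul h1
    refine h2.deriv.trans ?_
    simp [physHermitePoly]
    ring

lemma physHermiteR_eq_eval (k : ℕ) (x : ℝ) :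
    physHermiteR k x = (physHermitePoly k).eval x := by
  have h1 : Real.exp (x ^ 2) * Real.exp (-x ^ 2) = 1 := by
    rw [← Real.exp_add]; simp
  have h2 : ((-1 : ℝ) ^ k) * (-1) ^ k = 1 := by
    rw [← mul_pow]; simp
  rw [physHermiteR, iteratedDeriv_exp_neg_sq]
  linear_combination (physHermitePoly k).eval x * ((-1 : ℝ) ^ k * (-1) ^ k) * h1 +
    (physHermitePoly k).eval x * h2

lemma integrable_eval_mul_exp_neg_sq (p : ℝ[X]) :
    Integrable (fun x : ℝ => p.eval x * Real.exp (-x ^ 2)) := by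
  induction p using Polynomial.induction_on' with
  | add p q hp hq =>
    refine (hp.add hq).congr (Filter.Eventually.of_forall fun x => ?_)
    simp [add_mul]
  | monomial n c =>
    have h := (integrable_rpow_mul_exp_neg_mul_sq (b := 1) one_pos (s := n)
      (by have : (0 : ℝ) ≤ n := n.cast_nonneg
          linarith)).const_mul c
    simpa [mul_assoc] using h

lemma exp_mul_exp_neg_sq (a x : ℝ) :
    Real.exp (2 * a * x) * Real.exp (-x ^ 2) =
      Real.exp (a ^ 2) * Real.exp (-(x - a) ^ 2) := by
  rw [← Real.exp_add, ← Real.exp_add]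
  congr 1
  ring

lemma integrable_exp_mul_eval_mul_exp_neg_sq (a : ℝ) (p : ℝ[X]) :
    Integrable (fun x : ℝ => Real.exp (2 * a * x) * Real.exp (-x ^ 2) * p.eval x) := by
  have h := ((integrable_eval_mul_exp_neg_sq (p.comp (X + C a))).comp_sub_right a).const_mul
    (Real.exp (a ^ 2))
  refine h.congr (Filter.Eventually.of_forall fun x => ?_)
  simp only [exp_mul_exp_neg_sq]
  simp
  ring

/-- The functional `p ↦ ∫ e^{2ax} e^{-x²} p(x) dx` on real polynomials. -/
noncomputable def expGaussianFunctional (a : ℝ) : ℝ[X] →ₗ[ℝ] ℝ where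
  toFun p := ∫ x : ℝ, Real.exp (2 * a * x) * Real.exp (-x ^ 2) * p.eval x
  map_add' p q := by
    rw [← integral_add (integrable_exp_mul_eval_mul_exp_neg_sq a p)
      (integrable_exp_mul_eval_mul_exp_neg_sq a q)]
    simp [mul_add]
  map_smul' c p := by
    rw [RingHom.id_apply, smul_eq_mul, ← integral_const_mul]
    congr 1
    funext x
    simp
    ring

lemma expGaussianFunctional_one (a : ℝ) :
    expGaussianFunctional a 1 = Real.exp (a ^ 2) * Real.sqrt Real.pi := by
  have h := integral_gaussian 1
  simp only [neg_mul, one_mul, div_one] at h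
  have h2 := integral_sub_right_eq_self (μ := volume) (fun x : ℝ => Real.exp (-x ^ 2)) a
  simp only [expGaussianFunctional, LinearMap.coe_mk, AddHom.coe_mk, exp_mul_exp_neg_sq, eval_one,
    mul_one, integral_const_mul, h2, h]

lemma expGaussianFunctional_two_X_mul_sub_derivative (a : ℝ) (p : ℝ[X]) :
    expGaussianFunctional a (2 * X * p - derivative p) = 2 * a * expGaussianFunctional a p := by
  have hd (x : ℝ) : HasDerivAt
      (fun x : ℝ => Real.exp (2 * a * x) * Real.exp (-x ^ 2) * p.eval x)
      (Real.exp (2 * a * x) * Real.exp (-x ^ 2) *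
        (C (2 * a) * p - (2 * X * p - derivative p)).eval x) x := by
    have h1 : HasDerivAt (fun t : ℝ => Real.exp (-t ^ 2)) (Real.exp (-x ^ 2) * -(2 * x)) x := by
      simpa using ((hasDerivAt_pow 2 x).neg).exp
    have h2 : HasDerivAt (fun t : ℝ => Real.exp (2 * a * t)) (Real.exp (2 * a * x) * (2 * a)) x := by
      simpa using ((hasDerivAt_id x).const_mul (2 * a)).exp
    refine ((h2.mul h1).mul (p.hasDerivAt x)).congr_deriv ?_
    simp
    ring
  have h0 : expGaussianFunctional a (C (2 * a) * p - (2 * X * p - derivative p)) = 0 :=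
    integral_eq_zero_of_hasDerivAt_of_integrable hd
      (integrable_exp_mul_eval_mul_exp_neg_sq a _) (integrable_exp_mul_eval_mul_exp_neg_sq a p)
  rw [map_sub, ← Polynomial.smul_eq_C_mul, map_smul, smul_eq_mul] at h0
  linarith

lemma expGaussianFunctional_physHermitePoly_mul (a : ℝ) (n : ℕ) (q : ℝ[X]) :
    expGaussianFunctional a (physHermitePoly n * q) =
      expGaussianFunctional a
        (((derivative + (2 * a) • (1 : Module.End ℝ ℝ[X])) ^ n : Module.End ℝ ℝ[X]) q) := by
  induction n generalizing q with
  | zero => simp [physHermitePoly]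
  | succ n ih =>
    rw [pow_succ, Module.End.mul_apply, ← ih]
    have h : physHermitePoly (n + 1) * q =
        (2 * X * (physHermitePoly n * q) - derivative (physHermitePoly n * q)) +
          physHermitePoly n * derivative q := by
      simp only [physHermitePoly, derivative_mul]
      ring
    rw [h, map_add, expGaussianFunctional_two_X_mul_sub_derivative]
    simp [mul_add, add_comm]

lemma expGaussianFunctional_physHermitePoly (a : ℝ) (n : ℕ) :
    expGaussianFunctional a (physHermitePoly n) =
      (2 * a) ^ n * (Real.exp (a ^ 2) * Real.sqrt Real.pi) := by
  induction n with
  | zero => simp [physHermitePoly, expGaussianFunctional_one]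
  | succ n ih =>
    rw [physHermitePoly, expGaussianFunctional_two_X_mul_sub_derivative, ih]
    ring

lemma expGaussianFunctional_physHermitePoly_sq (a : ℝ) (k : ℕ) :
    expGaussianFunctional a (physHermitePoly k * physHermitePoly k) =
      2 ^ k * k.factorial * Real.sqrt Real.pi *
        (Real.exp (a ^ 2) *
          ∑ j ∈ Finset.range (k + 1), (k.choose j : ℝ) * (2 * a ^ 2) ^ j / j.factorial) := by
  have hc : Commute (derivative : Module.End ℝ ℝ[X]) ((2 * a) • (1 : Module.End ℝ ℝ[X])) :=
    (Commute.one_right _).smul_right _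
  rw [expGaussianFunctional_physHermitePoly_mul, hc.add_pow, LinearMap.sum_apply, map_sum,
    ← Finset.sum_range_reflect, Finset.mul_sum, Finset.mul_sum]
  refine Finset.sum_congr rfl fun j hj => ?_
  have hj : j ≤ k := Nat.lt_succ_iff.mp (Finset.mem_range.mp hj)
  obtain ⟨m, rfl⟩ := Nat.exists_eq_add_of_le hj
  have e1 : j + m + 1 - 1 - j = m := by omega
  have e2 : j + m - m = j := by omega
  have hch : (j + m).choose m = (j + m).choose j := Nat.choose_symm_add.symm
  have hdf : ((j + m).factorial : ℝ) = j.factorial * (j + m).descFactorial m := by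
    have := Nat.factorial_mul_descFactorial (n := j + m) (k := m) (by omega)
    rw [e2] at this
    exact_mod_cast this.symm
  rw [e1, e2, hch, _root_.smul_pow, one_pow, mul_smul_comm, mul_one,
    (Nat.cast_commute ((j + m).choose j) _).eq.symm, ← nsmul_eq_mul, LinearMap.smul_apply,
    LinearMap.smul_apply, iterate_derivative_physHermitePoly (by omega), e2, map_nsmul, map_smul,
    map_smul, expGaussianFunctional_physHermitePoly, hdf]
  have : (j.factorial : ℝ) ≠ 0 := by positivity
  simp only [nsmul_eq_mul, smul_eq_mul]
  field_simp
  ring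

/-- The integral is `e^{a²} L_k(-2a²)`, with `L_k` the Laguerre polynomial. -/
lemma integral_exp_mul_hermiteFunR_sq (a : ℝ) (k : ℕ) :
    ∫ x : ℝ, Real.exp (2 * a * x) * hermiteFunR k x ^ 2 =
      Real.exp (a ^ 2) *
        ∑ j ∈ Finset.range (k + 1), (k.choose j : ℝ) * (2 * a ^ 2) ^ j / j.factorial := by
  have hpos : 0 < 2 ^ k * (k.factorial : ℝ) * Real.sqrt Real.pi := by positivity
  have h (x : ℝ) : Real.exp (2 * a * x) * hermiteFunR k x ^ 2 =
      (2 ^ k * (k.factorial : ℝ) * Real.sqrt Real.pi)⁻¹ *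
        (Real.exp (2 * a * x) * Real.exp (-x ^ 2) *
          (physHermitePoly k * physHermitePoly k).eval x) := by
    rw [hermiteFunR, physHermiteR_eq_eval, mul_pow, mul_pow, inv_pow, Real.sq_sqrt hpos.le,
      ← Real.exp_nat_mul, eval_mul, show ((2 : ℕ) : ℝ) * (-x ^ 2 / 2) = -x ^ 2 by push_cast; ring]
    ring
  simp_rw [h]
  rw [integral_const_mul]
  refine (congrArg _ (expGaussianFunctional_physHermitePoly_sq a k)).trans ?_
  rw [inv_mul_cancel_left₀ hpos.ne']

end HermitePolynomials

section Asymptotics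

open Filter Topology

/-- An upper bound for the Laguerre polynomial `L_k(-y)`, which is the sum on the left. -/
lemma sum_choose_mul_pow_div_factorial_le {y : ℝ} (hy : 0 ≤ y) (k : ℕ) :
    ∑ j ∈ Finset.range (k + 1), (k.choose j : ℝ) * y ^ j / j.factorial ≤
      Real.exp (2 * Real.sqrt (k * y)) := by
  have hs : 0 ≤ Real.sqrt (k * y) := Real.sqrt_nonneg _
  have hs2 : Real.sqrt (k * y) ^ 2 = k * y := Real.sq_sqrt (by positivity)
  calc ∑ j ∈ Finset.range (k + 1), (k.choose j : ℝ) * y ^ j / j.factorial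
      ≤ ∑ j ∈ Finset.range (k + 1), (Real.sqrt (k * y) ^ j / j.factorial) ^ 2 := by
        refine Finset.sum_le_sum fun j _ => ?_
        have h : (k.choose j : ℝ) ≤ (k : ℝ) ^ j / j.factorial := Nat.choose_le_pow_div j k
        calc (k.choose j : ℝ) * y ^ j / j.factorial
            ≤ (k : ℝ) ^ j / j.factorial * y ^ j / j.factorial := by gcongr
          _ = (Real.sqrt (k * y) ^ j / j.factorial) ^ 2 := by
            rw [div_pow, ← pow_mul, mul_comm j 2, pow_mul, hs2, mul_pow]
            ring
    _ ≤ (∑ j ∈ Finset.range (k + 1), Real.sqrt (k * y) ^ j / j.factorial) ^ 2 :=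
        Finset.sum_sq_le_sq_sum_of_nonneg fun j _ => by positivity
    _ ≤ Real.exp (Real.sqrt (k * y)) ^ 2 := by
        gcongr
        exact Real.sum_le_exp_of_nonneg hs _
    _ = Real.exp (2 * Real.sqrt (k * y)) := by
        rw [← Real.exp_nat_mul]
        norm_cast

lemma log_factorial_le {n : ℕ} (hn : n ≠ 0) :
    Real.log n.factorial ≤ n * Real.log n - n + Real.log n / 2 + 1 := by
  obtain ⟨m, rfl⟩ := Nat.exists_eq_succ_of_ne_zero hn
  have h := Stirling.log_stirlingSeq'_antitone (Nat.zero_le m)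
  simp only [Function.comp_apply, Stirling.log_stirlingSeq_formula] at h
  have hm : ((m.succ : ℕ) : ℝ) ≠ 0 := by positivity
  rw [Real.log_div hm (Real.exp_ne_zero 1), Real.log_mul two_ne_zero hm, Real.log_exp] at h
  simp at h
  push_cast at h ⊢
  linarith

lemma le_log_sum_choose_mul_pow_div_factorial {y : ℝ} (hy : 0 < y) {k : ℕ}
    (hk : 1 ≤ Real.sqrt (k * y)) (hk' : Real.sqrt (k * y) ≤ k / 2) :
    2 * Real.sqrt (k * y) - Real.log (Real.sqrt (k * y)) - (4 + 2 * y) ≤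
      Real.log (∑ j ∈ Finset.range (k + 1), (k.choose j : ℝ) * y ^ j / j.factorial) := by
  set s := Real.sqrt (k * y)
  have hs2 : s ^ 2 = k * y := Real.sq_sqrt (by positivity)
  obtain ⟨j, hj⟩ : ∃ j, j = ⌊s⌋₊ := ⟨_, rfl⟩
  have hj1 : 1 ≤ j := hj ▸ Nat.le_floor (by simpa using hk)
  have hjs : (j : ℝ) ≤ s := hj ▸ Nat.floor_le (by positivity)
  have hsj : s < j + 1 := hj ▸ Nat.lt_floor_add_one s
  have hj1' : (1 : ℝ) ≤ j := by exact_mod_cast hj1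
  have hk0 : (0 : ℝ) < k := by linarith
  have hjk : j ≤ k := by
    have : (j : ℝ) ≤ k := by linarith
    exact_mod_cast this
  have hj2 : (j : ℝ) ^ 2 ≤ k * y := by rw [← hs2]; gcongr
  set r : ℝ := k + 1 - j
  have hrk : (k : ℝ) / 2 ≤ r := by linarith
  have hr0 : 0 < r := by linarith
  have hchoose : r ^ j / j.factorial ≤ k.choose j := by
    have h := Nat.pow_le_choose (α := ℝ) j k
    rwa [Nat.cast_sub (by omega), Nat.cast_add, Nat.cast_one] at h
  have hterm : (r * y) ^ j / (j.factorial : ℝ) ^ 2 ≤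
      ∑ j ∈ Finset.range (k + 1), (k.choose j : ℝ) * y ^ j / j.factorial := by
    calc (r * y) ^ j / (j.factorial : ℝ) ^ 2
        = r ^ j / j.factorial * y ^ j / j.factorial := by rw [mul_pow]; field_simp
      _ ≤ (k.choose j : ℝ) * y ^ j / j.factorial := by gcongr
      _ ≤ _ := Finset.single_le_sum (f := fun j => (k.choose j : ℝ) * y ^ j / j.factorial)
          (fun i _ => by positivity) (Finset.mem_range.mpr (by omega))
  refine le_trans ?_ (Real.log_le_log (by positivity) hterm)
  rw [Real.log_div (by positivity) (by positivity), Real.log_pow, Real.log_pow]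
  have hfac := log_factorial_le (n := j) (by omega)
  have hlogj : Real.log j ≤ Real.log s := Real.log_le_log (by linarith) hjs
  have hratio : 2 * Real.log j - 2 * j / k ≤ Real.log (r * y) := by
    have h1 : Real.log ((j : ℝ) ^ 2 * (r / k)) ≤ Real.log (r * y) := by
      refine Real.log_le_log (by positivity) ?_
      calc (j : ℝ) ^ 2 * (r / k) ≤ k * y * (r / k) := by gcongr
        _ = r * y := by field_simp
    have h2 := Real.one_sub_inv_le_log_of_pos (x := r / k) (by positivity)
    rw [Real.log_mul (by positivity) (by positivity), Real.log_pow] at h1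
    have h3 : -(2 * j / k) ≤ 1 - (r / k)⁻¹ := by
      rw [inv_div, neg_le_sub_iff_le_add, div_le_iff₀ hr0, add_mul, one_mul,
        div_mul_eq_mul_div]
      have : (j : ℝ) ≤ 2 * j * r / k := by
        rw [le_div_iff₀ hk0]
        nlinarith
      linarith
    push_cast at h1
    linarith
  have hmul : j * (2 * Real.log j) - 2 * y ≤ j * Real.log (r * y) := by
    have h1 := mul_le_mul_of_nonneg_left hratio (by positivity : (0 : ℝ) ≤ j)
    have h2 : (j : ℝ) * (2 * j / k) ≤ 2 * y := by
      rw [mul_div_assoc', div_le_iff₀ hk0]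
      nlinarith
    linarith
  push_cast
  linarith

end Asymptotics

/-- `lim_{k→∞} k^{-1/2} log ∫ e^{2ax} h_k(x)² dx = 2^{3/2} |a|`. -/
theorem stmt_8 (a : ℝ) (ha : a ≠ 0) :
    Filter.Tendsto
      (fun k : ℕ =>
        (1 / Real.sqrt k) *
          Real.log (∫ x : ℝ, Real.exp (2 * a * x) * hermiteFunR k x ^ 2))
      Filter.atTop (nhds (2 ^ ((3 : ℝ) / 2) * |a|)) := by
  set y : ℝ := 2 * a ^ 2 with hy
  have hy0 : 0 < y := by positivity
  have hlim : (2 : ℝ) ^ ((3 : ℝ) / 2) * |a| = 2 * Real.sqrt y := by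
    rw [hy, Real.sqrt_mul (by norm_num), Real.sqrt_sq_eq_abs, Real.sqrt_eq_rpow,
      show (3 : ℝ) / 2 = 1 + 1 / 2 by norm_num, Real.rpow_add two_pos, Real.rpow_one]
    ring
  rw [hlim]
  simp_rw [integral_exp_mul_hermiteFunR_sq]
  have hsum (k : ℕ) :
      0 < ∑ j ∈ Finset.range (k + 1), (k.choose j : ℝ) * y ^ j / j.factorial :=
    Finset.sum_pos (fun j hj => by
      have := Nat.choose_pos (Nat.lt_succ_iff.mp (Finset.mem_range.mp hj))
      positivity) ⟨0, by simp⟩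
  have hsqrt : Filter.Tendsto (fun k : ℕ => Real.sqrt k) Filter.atTop Filter.atTop :=
    Real.tendsto_sqrt_atTop.comp tendsto_natCast_atTop_atTop
  have hs : Filter.Tendsto (fun k : ℕ => Real.sqrt (k * y)) Filter.atTop Filter.atTop :=
    Real.tendsto_sqrt_atTop.comp (tendsto_natCast_atTop_atTop.atTop_mul_const hy0)
  have hconst (c : ℝ) : Filter.Tendsto (fun k : ℕ => c / Real.sqrt k) Filter.atTop (nhds 0) :=
    hsqrt.const_div_atTop c
  have hlog : Filter.Tendsto
      (fun k : ℕ => Real.log (Real.sqrt (k * y)) / Real.sqrt (k * y) * Real.sqrt y)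
      Filter.atTop (nhds 0) := by
    simpa using ((Real.isLittleO_log_id_atTop.tendsto_div_nhds_zero).comp hs).mul_const (√y)
  refine tendsto_of_tendsto_of_tendsto_of_le_of_le'
    (g := fun k : ℕ => 2 * Real.sqrt y -
      Real.log (Real.sqrt (k * y)) / Real.sqrt (k * y) * Real.sqrt y +
        (a ^ 2 - (4 + 2 * y)) / Real.sqrt k)
    (h := fun k : ℕ => 2 * Real.sqrt y + a ^ 2 / Real.sqrt k) ?_ ?_ ?_ ?_
  · simpa using (hlog.const_sub (2 * √y)).add (hconst (a ^ 2 - (4 + 2 * y)))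
  · simpa using (hconst (a ^ 2)).const_add (2 * √y)
  · filter_upwards [hs.eventually_ge_atTop 1, hsqrt.eventually_ge_atTop (2 * √y),
      Filter.eventually_gt_atTop 0] with k h1 h2 hk
    have hk0 : (0 : ℝ) < k := by exact_mod_cast hk
    have hmul : √(k * y) = √k * √y := Real.sqrt_mul hk0.le y
    have hk2 : √(k : ℝ) * √k = k := Real.mul_self_sqrt hk0.le
    have hpos : 0 < √(k : ℝ) := Real.sqrt_pos.mpr hk0
    have hpos' : 0 < √y := Real.sqrt_pos.mpr hy0
    have hle := le_log_sum_choose_mul_pow_div_factorial hy0 h1 (by rw [hmul]; nlinarith)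
    rw [Real.log_mul (Real.exp_ne_zero _) (hsum k).ne', Real.log_exp, one_div_mul_eq_div,
      le_div_iff₀ hpos]
    refine le_trans (le_of_eq ?_) (add_le_add_right hle (a ^ 2))
    rw [hmul]
    field_simp
    ring
  · filter_upwards [Filter.eventually_gt_atTop 0] with k hk
    have hk0 : (0 : ℝ) < k := by exact_mod_cast hk
    have hpos : 0 < √(k : ℝ) := Real.sqrt_pos.mpr hk0
    have hle := Real.log_le_log (hsum k) (sum_choose_mul_pow_div_factorial_le hy0.le k)
    rw [Real.log_exp, Real.sqrt_mul hk0.le] at hle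
    rw [Real.log_mul (Real.exp_ne_zero _) (hsum k).ne', Real.log_exp, one_div_mul_eq_div,
      div_le_iff₀ hpos]
    refine (add_le_add_right hle (a ^ 2)).trans (le_of_eq ?_)
    field_simp
    ring
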